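/- Assume in addition that ρ > 4λ‖A⁻¹‖. Then δ₀ := ρ/2 − 4λ²‖A⁻¹‖²/ρ > 0 and for every k ≥ 1 the ADMM iterates satisfy the descent inequality δ₀·‖A(c^{k+1} − c^k)‖² ≤ L_ρ(α^k, c^k, γ^k) − L_ρ(α^{k+1}, c^{k+1}, γ^{k+1}); in particular the sequence (L_ρ(α^k, c^k, γ^k))_{k≥1} is monotonically nonincreasing. -/

import Mathlib

open Matrix

/-- The Euclidean (2-)norm on `ℝ^N`. -/
noncomputable def euclNorm {N : ℕ} (v : Fin N → ℝ) : ℝ :=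
  Real.sqrt (∑ i, v i ^ 2)

/-- The operator 2-norm of an `N × N` real matrix (as an operator on Euclidean space). -/
noncomputable def opNorm2 {N : ℕ} (M : Matrix (Fin N) (Fin N) ℝ) : ℝ :=
  ‖(Matrix.toEuclideanLin M).toContinuousLinearMap‖

/-- The augmented Lagrangian
`L_ρ(α, c, γ) = F(α) + λcᵀAc + γᵀ(α − Ac) + (ρ/2)‖α − Ac‖²`. -/
noncomputable def augLag {N : ℕ} (F : (Fin N → ℝ) → ℝ) (A : Matrix (Fin N) (Fin N) ℝ)
    (lam ρ : ℝ) (a c g : Fin N → ℝ) : ℝ :=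
  F a + lam * (c ⬝ᵥ A.mulVec c) + g ⬝ᵥ (a - A.mulVec c) +
    ρ / 2 * euclNorm (a - A.mulVec c) ^ 2

lemma euclNorm_sq {N : ℕ} (v : Fin N → ℝ) : euclNorm v ^ 2 = v ⬝ᵥ v := by
  rw [euclNorm, Real.sq_sqrt (Finset.sum_nonneg fun i _ => sq_nonneg _)]
  simp [dotProduct, sq]

lemma euclNorm_eq_norm {N : ℕ} (v : Fin N → ℝ) : euclNorm v = ‖WithLp.toLp 2 v‖ := by
  simp [euclNorm, EuclideanSpace.norm_eq]

lemma opNorm2_nonneg {N : ℕ} (M : Matrix (Fin N) (Fin N) ℝ) : 0 ≤ opNorm2 M :=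
  norm_nonneg _

lemma euclNorm_mulVec_le {N : ℕ} (M : Matrix (Fin N) (Fin N) ℝ) (v : Fin N → ℝ) :
    euclNorm (M *ᵥ v) ≤ opNorm2 M * euclNorm v := by
  rw [euclNorm_eq_norm, euclNorm_eq_norm]
  exact (Matrix.toEuclideanLin M).toContinuousLinearMap.le_opNorm (WithLp.toLp 2 v)

lemma Matrix.IsSymm.dotProduct_mulVec_comm {N : ℕ} {A : Matrix (Fin N) (Fin N) ℝ}
    (hA : A.IsSymm) (x y : Fin N → ℝ) : x ⬝ᵥ A *ᵥ y = A *ᵥ x ⬝ᵥ y := by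
  rw [dotProduct_mulVec, ← mulVec_transpose, hA.eq]

lemma augLag_add_right {N : ℕ} (F : (Fin N → ℝ) → ℝ) {A : Matrix (Fin N) (Fin N) ℝ}
    (hA : A.IsSymm) (lam ρ : ℝ) (a c e g : Fin N → ℝ) :
    augLag F A lam ρ a (c + e) g = augLag F A lam ρ a c g
      + A *ᵥ e ⬝ᵥ ((2 * lam) • c - (g + ρ • (a - A *ᵥ c)))
      + (lam * (e ⬝ᵥ A *ᵥ e) + ρ / 2 * euclNorm (A *ᵥ e) ^ 2) := by
  have h₁ : e ⬝ᵥ A *ᵥ c = A *ᵥ e ⬝ᵥ c := hA.dotProduct_mulVec_comm e c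
  have h₂ : c ⬝ᵥ A *ᵥ e = A *ᵥ e ⬝ᵥ c := dotProduct_comm _ _
  have h₃ : g ⬝ᵥ A *ᵥ e = A *ᵥ e ⬝ᵥ g := dotProduct_comm _ _
  have h₄ : a ⬝ᵥ A *ᵥ e = A *ᵥ e ⬝ᵥ a := dotProduct_comm _ _
  have h₅ : A *ᵥ c ⬝ᵥ A *ᵥ e = A *ᵥ e ⬝ᵥ A *ᵥ c := dotProduct_comm _ _
  simp only [augLag, euclNorm_sq, mulVec_add, dotProduct_add, add_dotProduct, dotProduct_sub,
    sub_dotProduct, dotProduct_smul, smul_eq_mul, h₁, h₂, h₃, h₄, h₅]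
  ring

lemma augLag_add_multiplier {N : ℕ} (F : (Fin N → ℝ) → ℝ) (A : Matrix (Fin N) (Fin N) ℝ)
    (lam ρ : ℝ) (a c g h : Fin N → ℝ) :
    augLag F A lam ρ a c (g + h) = augLag F A lam ρ a c g + h ⬝ᵥ (a - A *ᵥ c) := by
  simp only [augLag, add_dotProduct]
  ring

lemma eq_zero_of_forall_nonneg_mul_add_sq {b q : ℝ} (h : ∀ t : ℝ, 0 ≤ t * b + t ^ 2 * q) :
    b = 0 := by
  have hd := discrim_le_zero (a := q) (b := b) (c := 0) fun t => by linarith [h t]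
  rw [discrim] at hd
  nlinarith [sq_nonneg b]

/-- First-order optimality of the `c`-step: the updated multiplier equals `2λc`. -/
lemma multiplier_eq_of_isMin_augLag {N : ℕ} {F : (Fin N → ℝ) → ℝ}
    {A : Matrix (Fin N) (Fin N) ℝ} (hA : A.IsSymm) (hdet : IsUnit A.det) {lam ρ : ℝ}
    {a c g : Fin N → ℝ} (hc : ∀ b, augLag F A lam ρ a c g ≤ augLag F A lam ρ a b g) :
    g + ρ • (a - A *ᵥ c) = (2 * lam) • c := by
  set w := (2 * lam) • c - (g + ρ • (a - A *ᵥ c)) with hw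
  have hAe : A *ᵥ (A⁻¹ *ᵥ w) = w := by
    rw [mulVec_mulVec, mul_nonsing_inv _ hdet, one_mulVec]
  have hww : w ⬝ᵥ w = 0 := by
    refine eq_zero_of_forall_nonneg_mul_add_sq
      (q := lam * (A⁻¹ *ᵥ w ⬝ᵥ w) + ρ / 2 * euclNorm w ^ 2) fun t => ?_
    have h := hc (c + t • (A⁻¹ *ᵥ w))
    rw [augLag_add_right F hA, ← hw, mulVec_smul, hAe] at h
    simp only [euclNorm_sq, smul_dotProduct, dotProduct_smul, smul_eq_mul] at h ⊢
    linarith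
  exact (sub_eq_zero.mp (hw ▸ dotProduct_self_eq_zero.mp hww)).symm

/-- **Descent inequality (Lemma 4.2)**: if `ρ > 4λ‖A⁻¹‖`, then
`δ₀ := ρ/2 − 4λ²‖A⁻¹‖²/ρ > 0` and for every `k ≥ 1`,
`δ₀‖A(c^{k+1} − c^k)‖² ≤ L_ρ(α^k, c^k, γ^k) − L_ρ(α^{k+1}, c^{k+1}, γ^{k+1})`;
in particular `(L_ρ(α^k, c^k, γ^k))_{k≥1}` is monotonically nonincreasing. -/
theorem admm_descent_inequality
    (N : ℕ) (hN : 0 < N) (A : Matrix (Fin N) (Fin N) ℝ)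
    (hAsymm : A.IsSymm) (hA : A.PosDef)
    (lam ρ : ℝ) (hlam : 0 < lam) (hρ : 0 < ρ)
    (F : (Fin N → ℝ) → ℝ) (hF0 : ∀ v, 0 ≤ F v) (hFlsc : LowerSemicontinuous F)
    (α c γ : ℕ → Fin N → ℝ)
    (hα : ∀ k, ∀ a : Fin N → ℝ,
      augLag F A lam ρ (α (k+1)) (c k) (γ k) ≤ augLag F A lam ρ a (c k) (γ k))
    (hc : ∀ k, ∀ b : Fin N → ℝ,
      augLag F A lam ρ (α (k+1)) (c (k+1)) (γ k) ≤ augLag F A lam ρ (α (k+1)) b (γ k))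
    (hγ : ∀ k, γ (k+1) = γ k + ρ • (α (k+1) - A.mulVec (c (k+1))))
    (hρbig : 4 * lam * opNorm2 A⁻¹ < ρ) :
    0 < ρ / 2 - 4 * lam ^ 2 * opNorm2 A⁻¹ ^ 2 / ρ ∧
    (∀ k : ℕ, 1 ≤ k →
      (ρ / 2 - 4 * lam ^ 2 * opNorm2 A⁻¹ ^ 2 / ρ) *
          euclNorm (A.mulVec (c (k+1) - c k)) ^ 2 ≤
        augLag F A lam ρ (α k) (c k) (γ k) -
          augLag F A lam ρ (α (k+1)) (c (k+1)) (γ (k+1))) ∧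
    (∀ k : ℕ, 1 ≤ k →
      augLag F A lam ρ (α (k+1)) (c (k+1)) (γ (k+1)) ≤
        augLag F A lam ρ (α k) (c k) (γ k)) := by
  have hdet : IsUnit A.det := hA.det_pos.ne'.isUnit
  have hm := opNorm2_nonneg A⁻¹
  set m := opNorm2 A⁻¹
  have hδ : 0 < ρ / 2 - 4 * lam ^ 2 * m ^ 2 / ρ := by
    rw [sub_pos, div_lt_div_iff₀ hρ two_pos]
    have : 0 ≤ 4 * lam * m := by positivity
    nlinarith
  have hmult : ∀ k, γ (k + 1) = (2 * lam) • c (k + 1) := fun k =>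
    (hγ k).trans (multiplier_eq_of_isMin_augLag hAsymm hdet (hc k))
  have hdesc : ∀ k : ℕ, 1 ≤ k →
      (ρ / 2 - 4 * lam ^ 2 * m ^ 2 / ρ) * euclNorm (A *ᵥ (c (k + 1) - c k)) ^ 2 ≤
        augLag F A lam ρ (α k) (c k) (γ k) -
          augLag F A lam ρ (α (k + 1)) (c (k + 1)) (γ (k + 1)) := by
    intro k hk
    obtain ⟨j, rfl⟩ := Nat.exists_eq_add_of_le' hk
    set d := c (j + 1 + 1) - c (j + 1) with hd
    set r := α (j + 1 + 1) - A *ᵥ c (j + 1 + 1) with hr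
    have hαstep := hα (j + 1) (α (j + 1))
    have hcstep := augLag_add_right F hAsymm lam ρ (α (j + 1 + 1)) (c (j + 1 + 1)) (-d)
      (γ (j + 1))
    rw [← hγ (j + 1), hmult (j + 1), sub_self, dotProduct_zero,
      show c (j + 1 + 1) + -d = c (j + 1) by rw [hd]; abel] at hcstep
    simp only [euclNorm_sq, mulVec_neg, neg_dotProduct_neg] at hcstep
    have hγstep := augLag_add_multiplier F A lam ρ (α (j + 1 + 1)) (c (j + 1 + 1)) (γ (j + 1))
      (ρ • r)
    rw [← hγ (j + 1), ← hr, smul_dotProduct, smul_eq_mul] at hγstep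
    have hres : ρ • r = (2 * lam) • d := by
      rw [hd, smul_sub (2 * lam), ← hmult, ← hmult, hγ (j + 1), add_sub_cancel_left]
    have hrr : ρ * (r ⬝ᵥ r) = 4 * lam ^ 2 / ρ * (d ⬝ᵥ d) := by
      have h := congrArg (fun v => v ⬝ᵥ v) hres
      simp only [smul_dotProduct, dotProduct_smul, smul_eq_mul] at h
      field_simp
      linarith
    have hdd : d ⬝ᵥ d ≤ m ^ 2 * (A *ᵥ d ⬝ᵥ A *ᵥ d) := by
      have h := euclNorm_mulVec_le A⁻¹ (A *ᵥ d)
      rw [mulVec_mulVec, nonsing_inv_mul _ hdet, one_mulVec] at h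
      rw [← euclNorm_sq, ← euclNorm_sq, ← mul_pow]
      exact pow_le_pow_left₀ (Real.sqrt_nonneg _) h 2
    have hpos : 0 ≤ lam * (d ⬝ᵥ A *ᵥ d) :=
      mul_nonneg hlam.le (by simpa using hA.posSemidef.dotProduct_mulVec_nonneg d)
    have hbound := mul_le_mul_of_nonneg_left hdd (show 0 ≤ 4 * lam ^ 2 / ρ by positivity)
    rw [euclNorm_sq]
    calc (ρ / 2 - 4 * lam ^ 2 * m ^ 2 / ρ) * (A *ᵥ d ⬝ᵥ A *ᵥ d)
        = ρ / 2 * (A *ᵥ d ⬝ᵥ A *ᵥ d)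
          - 4 * lam ^ 2 / ρ * (m ^ 2 * (A *ᵥ d ⬝ᵥ A *ᵥ d)) := by ring
      _ ≤ _ := by linarith
  exact ⟨hδ, hdesc, fun k hk =>
    sub_nonneg.mp ((mul_nonneg hδ.le (sq_nonneg _)).trans (hdesc k hk))⟩
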